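/- Let Φ ∈ ℝ and d(Φ) = dist(Φ, ℤ). Then for every u ∈ C_c^∞(ℝ²\{0}; ℂ): ∫_{ℝ²} |D_Φ u(x)|² dx ≥ d(Φ)² ∫_{ℝ²} |u(x)|² / |x|² dx. (Magnetic Hardy inequality for the Aharonov–Bohm field.) -/

import Mathlib

open MeasureTheory

/-- The square of the Euclidean norm on `ℝ²`. -/
noncomputable def sqnorm (x : ℝ × ℝ) : ℝ := x.1 ^ 2 + x.2 ^ 2

/-- Smooth compactly supported functions on `ℝ²` vanishing in a neighbourhood of `0`. -/
def IsTestFun (u : ℝ × ℝ → ℂ) : Prop :=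
  ContDiff ℝ (⊤ : ℕ∞) u ∧ HasCompactSupport u ∧ ∀ᶠ x in nhds (0 : ℝ × ℝ), u x = 0

/-- The magnetic energy `∫ |D_Φ u|²` for the Aharonov–Bohm vector potential
`A(x) = |x|⁻² (x₂, -x₁)`, where `D_Φ u = -i∇u + Φ A u`. -/
noncomputable def magEnergy (Φ : ℝ) (u : ℝ × ℝ → ℂ) : ℝ :=
  ∫ x : ℝ × ℝ,
    (‖-Complex.I * fderiv ℝ u x (1, 0) + ((Φ * (x.2 / sqnorm x) : ℝ) : ℂ) * u x‖ ^ 2 +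
     ‖-Complex.I * fderiv ℝ u x (0, 1) + ((Φ * (-x.1 / sqnorm x) : ℝ) : ℂ) * u x‖ ^ 2)

/-- A subspace `M` of test functions is `V`-negative for `D_Φ` if
every nonzero `u ∈ M` satisfies `∫ |D_Φ u|² < ∫ V |u|²`. -/
def IsVNegative (Φ : ℝ) (V : ℝ × ℝ → ℝ) (M : Submodule ℂ (ℝ × ℝ → ℂ)) : Prop :=
  (∀ u ∈ M, IsTestFun u) ∧
  ∀ u ∈ M, u ≠ 0 → magEnergy Φ u < ∫ x : ℝ × ℝ, V x * ‖u x‖ ^ 2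

/-- The distance `d(Φ) = min_{k ∈ ℤ} |Φ - k|` of a real number to the integers. -/
noncomputable def distToInt (Φ : ℝ) : ℝ := |Φ - round Φ|

/-- Fourier coefficients of the derivative of a `C¹` function with equal boundary values. -/
lemma fourierCoeffOn_deriv_of_eq {a b : ℝ} (hab : a < b) {f f' : ℝ → ℂ}
    (hf : ∀ x, HasDerivAt f (f' x) x) (hf' : Continuous f') (hper : f b = f a) (n : ℤ) :
    ((b - a : ℝ) : ℂ) * fourierCoeffOn hab f' n
      = 2 * Real.pi * Complex.I * n * fourierCoeffOn hab f n := by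
  rcases eq_or_ne n 0 with rfl | hn
  · have h : ∫ x in a..b, f' x = 0 := by
      rw [intervalIntegral.integral_eq_sub_of_hasDerivAt (fun x _ => hf x)
        (hf'.intervalIntegrable _ _), hper, sub_self]
    rw [fourierCoeffOn_eq_integral]
    simp [h]
  · rw [fourierCoeffOn_of_hasDerivAt hab hn (fun x _ => hf x) (hf'.intervalIntegrable _ _), hper]
    have h1 : (n : ℂ) ≠ 0 := Int.cast_ne_zero.mpr hn
    have h2 : (Real.pi : ℂ) ≠ 0 := Complex.ofReal_ne_zero.mpr Real.pi_ne_zero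
    have h3 := Complex.I_ne_zero
    push_cast
    field_simp
    ring

lemma fourierCoeffOn_add_of_continuous {a b : ℝ} (hab : a < b) {f g : ℝ → ℂ}
    (hf : Continuous f) (hg : Continuous g) (n : ℤ) :
    fourierCoeffOn hab (fun x => f x + g x) n
      = fourierCoeffOn hab f n + fourierCoeffOn hab g n := by
  have hF : Continuous fun x : ℝ => fourier (-n) (x : AddCircle (b - a)) :=
    (map_continuous (fourier (-n))).comp (AddCircle.continuous_mk' _)
  simp only [fourierCoeffOn_eq_integral, smul_add]
  rw [intervalIntegral.integral_add, smul_add]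
  · exact (hF.smul hf).intervalIntegrable _ _
  · exact (hF.smul hg).intervalIntegrable _ _

/-- The Hardy inequality for the magnetic derivative `-i ∂_θ - Φ` on the circle. -/
lemma circle_magnetic_inequality (Φ : ℝ) {f f' : ℝ → ℂ}
    (hf : ∀ x, HasDerivAt f (f' x) x) (hf' : Continuous f')
    (hper : f Real.pi = f (-Real.pi)) :
    distToInt Φ ^ 2 * ∫ θ in (-Real.pi)..Real.pi, ‖f θ‖ ^ 2
      ≤ ∫ θ in (-Real.pi)..Real.pi, ‖-Complex.I * f' θ + (-Φ : ℂ) * f θ‖ ^ 2 := by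
  have hab : -Real.pi < Real.pi := by linarith [Real.pi_pos]
  have hfc : Continuous f := continuous_iff_continuousAt.mpr fun x => (hf x).continuousAt
  have hgc : Continuous fun θ => -Complex.I * f' θ + (-Φ : ℂ) * f θ := by fun_prop
  have memLp {h : ℝ → ℂ} (hh : Continuous h) :
      MemLp h 2 (volume.restrict (Set.Ioc (-Real.pi) Real.pi)) := by
    rw [memLp_two_iff_integrable_sq_norm hh.aestronglyMeasurable]
    exact ((hh.norm.pow 2).integrableOn_Icc (a := -Real.pi) (b := Real.pi)).mono_set
      Set.Ioc_subset_Icc_self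
  have coeff (n : ℤ) : fourierCoeffOn hab (fun θ => -Complex.I * f' θ + (-Φ : ℂ) * f θ) n
      = ((n - Φ : ℝ) : ℂ) * fourierCoeffOn hab f n := by
    rw [fourierCoeffOn_add_of_continuous hab (by fun_prop) (by fun_prop),
      fourierCoeffOn.const_mul, fourierCoeffOn.const_mul]
    have h := fourierCoeffOn_deriv_of_eq hab hf hf' hper n
    have h2 : (Real.pi : ℂ) ≠ 0 := Complex.ofReal_ne_zero.mpr Real.pi_ne_zero
    have h3 : fourierCoeffOn hab f' n = Complex.I * n * fourierCoeffOn hab f n := by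
      have h4 : (2 * Real.pi : ℂ) ≠ 0 := mul_ne_zero two_ne_zero h2
      apply mul_left_cancel₀ h4
      push_cast at h
      linear_combination h
    rw [h3]
    push_cast
    linear_combination (-(n : ℂ) * fourierCoeffOn hab f n) * Complex.I_mul_I
  have key := hasSum_le (fun n : ℤ => ?_)
    ((hasSum_sq_fourierCoeffOn hab (memLp hfc)).mul_left (distToInt Φ ^ 2))
    (hasSum_sq_fourierCoeffOn hab (memLp hgc))
  · simp only [smul_eq_mul] at key
    rw [mul_left_comm] at key
    exact le_of_mul_le_mul_left key (inv_pos.mpr (by linarith))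
  · rw [coeff, norm_mul, mul_pow, Complex.norm_real, Real.norm_eq_abs]
    have : distToInt Φ ≤ |(n : ℝ) - Φ| := by
      rw [abs_sub_comm]
      exact round_le Φ n
    have h0 : 0 ≤ distToInt Φ := abs_nonneg _
    gcongr

/-- Integrability in polar coordinates of a continuous compactly supported function. -/
lemma integrableOn_polar {f : ℝ × ℝ → ℝ} (hf : Continuous f) (hs : HasCompactSupport f) :
    IntegrableOn (fun p : ℝ × ℝ => p.1 * f (p.1 * Real.cos p.2, p.1 * Real.sin p.2))
      (Set.Ioi 0 ×ˢ Set.Ioo (-Real.pi) Real.pi) := by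
  obtain ⟨R, hR⟩ := hs.isCompact.isBounded.subset_closedBall 0
  have hc : Continuous fun p : ℝ × ℝ =>
      p.1 * f (p.1 * Real.cos p.2, p.1 * Real.sin p.2) := by fun_prop
  have hK : IntegrableOn (fun p : ℝ × ℝ => p.1 * f (p.1 * Real.cos p.2, p.1 * Real.sin p.2))
      (Set.Icc 0 (2 * R) ×ˢ Set.Icc (-Real.pi) Real.pi) :=
    hc.continuousOn.integrableOn_compact (isCompact_Icc.prod isCompact_Icc)
  refine hK.of_forall_sdiff_eq_zero (measurableSet_Ioi.prod measurableSet_Ioo) ?_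
  rintro ⟨r, θ⟩ ⟨⟨hr, hθ⟩, hn⟩
  simp only [Set.mem_Ioi] at hr
  have hrR : 2 * R < r := by
    by_contra! h
    exact hn ⟨⟨hr.le, h⟩, Set.Ioo_subset_Icc_self hθ⟩
  have h0 : f (r * Real.cos θ, r * Real.sin θ) = 0 := by
    by_contra hne
    have hm := hR (subset_tsupport f hne)
    rw [mem_closedBall_zero_iff, Prod.norm_def, max_le_iff] at hm
    simp only [Real.norm_eq_abs] at hm
    have h1 := sq_le_sq' (abs_le.mp hm.1).1 (abs_le.mp hm.1).2
    have h2 := sq_le_sq' (abs_le.mp hm.2).1 (abs_le.mp hm.2).2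
    have hR0 : 0 ≤ R := (abs_nonneg _).trans hm.1
    have h3 : r ^ 2 = (r * Real.cos θ) ^ 2 + (r * Real.sin θ) ^ 2 := by
      linear_combination -r ^ 2 * Real.sin_sq_add_cos_sq θ
    nlinarith
  simp [h0]

/-- Integration in polar coordinates as an iterated integral. -/
lemma integral_eq_polar {f : ℝ × ℝ → ℝ} (hf : Continuous f) (hs : HasCompactSupport f) :
    ∫ x, f x = ∫ r in Set.Ioi (0 : ℝ),
      ∫ θ in (-Real.pi)..Real.pi, r * f (r * Real.cos θ, r * Real.sin θ) := by
  rw [← integral_comp_polarCoord_symm]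
  simp only [polarCoord_target, polarCoord_symm_apply, smul_eq_mul]
  rw [Measure.volume_eq_prod, setIntegral_prod _ (integrableOn_polar hf hs)]
  simp only [intervalIntegral.integral_of_le (neg_le_self Real.pi_pos.le),
    integral_Ioc_eq_integral_Ioo]

lemma integrableOn_integral_polar {f : ℝ × ℝ → ℝ} (hf : Continuous f)
    (hs : HasCompactSupport f) :
    IntegrableOn (fun r : ℝ =>
      ∫ θ in (-Real.pi)..Real.pi, r * f (r * Real.cos θ, r * Real.sin θ)) (Set.Ioi 0) := by
  have h := integrableOn_polar hf hs
  rw [IntegrableOn, Measure.volume_eq_prod, ← Measure.prod_restrict] at h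
  simpa only [IntegrableOn, intervalIntegral.integral_of_le (neg_le_self Real.pi_pos.le),
    integral_Ioc_eq_integral_Ioo] using h.integral_prod_left

lemma sqnorm_pos {x : ℝ × ℝ} (hx : x ≠ 0) : 0 < sqnorm x := by
  unfold sqnorm
  by_contra! h
  have h1 : x.1 ^ 2 = 0 := by linarith [sq_nonneg x.1, sq_nonneg x.2]
  have h2 : x.2 ^ 2 = 0 := by linarith [sq_nonneg x.1, sq_nonneg x.2]
  exact hx (Prod.ext (pow_eq_zero_iff two_ne_zero |>.mp h1)
    (pow_eq_zero_iff two_ne_zero |>.mp h2))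

lemma continuous_sqnorm : Continuous sqnorm := by
  unfold sqnorm
  fun_prop

/-- A function vanishing near `0` and continuous away from `0` is continuous. -/
lemma continuous_of_eventually_zero {f : ℝ × ℝ → ℝ} (h0 : ∀ᶠ x in nhds 0, f x = 0)
    (h : ∀ x ≠ 0, ContinuousAt f x) : Continuous f := by
  refine continuous_iff_continuousAt.mpr fun x => ?_
  rcases eq_or_ne x 0 with rfl | hx
  · exact (continuousAt_const (y := (0 : ℝ))).congr (h0.mono fun _ hy => hy.symm)
  · exact h x hx

/-- The angular part of the magnetic derivative, multiplied by the radius. -/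
noncomputable def angularDeriv (Φ : ℝ) (u : ℝ × ℝ → ℂ) (x : ℝ × ℝ) : ℂ :=
  -Complex.I * fderiv ℝ u x (-x.2, x.1) + (-Φ : ℂ) * u x

lemma norm_sq_add_le (a b : ℝ) (z w : ℂ) :
    ‖a * z + b * w‖ ^ 2 ≤ (a ^ 2 + b ^ 2) * (‖z‖ ^ 2 + ‖w‖ ^ 2) := by
  have h : ‖a * z + b * w‖ ≤ |a| * ‖z‖ + |b| * ‖w‖ := by
    simpa [norm_mul] using norm_add_le ((a : ℂ) * z) (b * w)
  calc ‖a * z + b * w‖ ^ 2 ≤ (|a| * ‖z‖ + |b| * ‖w‖) ^ 2 := by gcongr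
    _ ≤ (|a| ^ 2 + |b| ^ 2) * (‖z‖ ^ 2 + ‖w‖ ^ 2) := by
      nlinarith [sq_nonneg (|a| * ‖w‖ - |b| * ‖z‖)]
    _ = _ := by rw [sq_abs, sq_abs]

lemma angularDeriv_le (Φ : ℝ) (u : ℝ × ℝ → ℂ) (x : ℝ × ℝ) :
    ‖angularDeriv Φ u x‖ ^ 2 / sqnorm x ≤
      ‖-Complex.I * fderiv ℝ u x (1, 0) + ((Φ * (x.2 / sqnorm x) : ℝ) : ℂ) * u x‖ ^ 2 +
      ‖-Complex.I * fderiv ℝ u x (0, 1) + ((Φ * (-x.1 / sqnorm x) : ℝ) : ℂ) * u x‖ ^ 2 := by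
  rcases eq_or_ne x 0 with rfl | hx
  · simp only [sqnorm, Prod.fst_zero, Prod.snd_zero]
    norm_num
    positivity
  have hs := sqnorm_pos hx
  rw [div_le_iff₀ hs, mul_comm]
  have hdecomp : ((-x.2, x.1) : ℝ × ℝ) = (-x.2) • (1, 0) + x.1 • (0, 1) := by simp
  have hsC : (sqnorm x : ℂ) ≠ 0 := Complex.ofReal_ne_zero.mpr hs.ne'
  have heq : angularDeriv Φ u x = ((-x.2 : ℝ) : ℂ) *
        (-Complex.I * fderiv ℝ u x (1, 0) + ((Φ * (x.2 / sqnorm x) : ℝ) : ℂ) * u x) +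
      (x.1 : ℂ) *
        (-Complex.I * fderiv ℝ u x (0, 1) + ((Φ * (-x.1 / sqnorm x) : ℝ) : ℂ) * u x) := by
    have h1 : (sqnorm x : ℂ) = (x.1 : ℂ) ^ 2 + (x.2 : ℂ) ^ 2 := by simp [sqnorm]
    rw [angularDeriv, hdecomp, map_add, map_smul, map_smul, Complex.real_smul, Complex.real_smul]
    push_cast
    field_simp
    rw [h1]
    ring
  rw [heq]
  refine (norm_sq_add_le _ _ _ _).trans_eq ?_
  rw [sqnorm, neg_sq, add_comm (x.2 ^ 2)]

theorem magnetic_Hardy_AharonovBohm (Φ : ℝ) (u : ℝ × ℝ → ℂ) (hu : IsTestFun u) :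
    distToInt Φ ^ 2 * ∫ x : ℝ × ℝ, ‖u x‖ ^ 2 / sqnorm x ≤ magEnergy Φ u := by
  obtain ⟨hsmooth, hcs, hzero⟩ := hu
  have hdiff : Differentiable ℝ u := hsmooth.differentiable (by simp)
  have huc : Continuous u := hsmooth.continuous
  have hduc : Continuous (fderiv ℝ u) := hsmooth.continuous_fderiv (by simp)
  have hdzero : ∀ᶠ x in nhds (0 : ℝ × ℝ), fderiv ℝ u x = 0 := by
    filter_upwards [hzero.eventually_nhds] with x hx
    have : u =ᶠ[nhds x] fun _ => 0 := hx
    rw [this.fderiv_eq]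
    simp
  have hu0 : ∀ x ∉ tsupport u, u x = 0 := fun x hx => image_eq_zero_of_notMem_tsupport hx
  have hdu0 : ∀ x ∉ tsupport u, fderiv ℝ u x = 0 := fun x hx =>
    Function.notMem_support.mp fun h => hx (support_fderiv_subset ℝ h)
  have hangc : Continuous (angularDeriv Φ u) := by
    unfold angularDeriv
    fun_prop
  have hsc (x : ℝ × ℝ) : ContinuousAt sqnorm x := continuous_sqnorm.continuousAt
  -- continuity and compact support of the three integrands
  have hKc : Continuous fun x => ‖u x‖ ^ 2 / sqnorm x := by
    refine continuous_of_eventually_zero (hzero.mono fun x hx => by simp [hx]) fun x hx => ?_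
    exact (huc.norm.pow 2).continuousAt.div (hsc x) (sqnorm_pos hx).ne'
  have hKs : HasCompactSupport fun x => ‖u x‖ ^ 2 / sqnorm x :=
    HasCompactSupport.intro hcs.isCompact fun x hx => by simp [hu0 x hx]
  have hHc : Continuous fun x => ‖angularDeriv Φ u x‖ ^ 2 / sqnorm x := by
    refine continuous_of_eventually_zero ?_ fun x hx => ?_
    · filter_upwards [hzero, hdzero] with x hx hdx
      simp [angularDeriv, hx, hdx]
    · exact (hangc.norm.pow 2).continuousAt.div (hsc x) (sqnorm_pos hx).ne'
  have hHs : HasCompactSupport fun x => ‖angularDeriv Φ u x‖ ^ 2 / sqnorm x :=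
    HasCompactSupport.intro hcs.isCompact fun x hx => by
      simp [angularDeriv, hu0 x hx, hdu0 x hx]
  have hGc : Continuous fun x : ℝ × ℝ =>
      (‖-Complex.I * fderiv ℝ u x (1, 0) + ((Φ * (x.2 / sqnorm x) : ℝ) : ℂ) * u x‖ ^ 2 +
       ‖-Complex.I * fderiv ℝ u x (0, 1) + ((Φ * (-x.1 / sqnorm x) : ℝ) : ℂ) * u x‖ ^ 2) := by
    refine continuous_of_eventually_zero ?_ fun x hx => ?_
    · filter_upwards [hzero, hdzero] with x hx hdx
      simp [hx, hdx]
    · have hx' := (sqnorm_pos hx).ne'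
      have h1 : ContinuousAt (fun x : ℝ × ℝ => ((Φ * (x.2 / sqnorm x) : ℝ) : ℂ)) x :=
        Complex.continuous_ofReal.continuousAt.comp
          (continuousAt_const.mul (continuousAt_snd.div (hsc x) hx'))
      have h2 : ContinuousAt (fun x : ℝ × ℝ => ((Φ * (-x.1 / sqnorm x) : ℝ) : ℂ)) x :=
        Complex.continuous_ofReal.continuousAt.comp
          (continuousAt_const.mul (continuousAt_fst.neg.div (hsc x) hx'))
      have hd (v : ℝ × ℝ) : ContinuousAt (fun x => -Complex.I * fderiv ℝ u x v) x := by fun_prop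
      exact (((hd _).add (h1.mul huc.continuousAt)).norm.pow 2).add
        (((hd _).add (h2.mul huc.continuousAt)).norm.pow 2)
  have hGs : HasCompactSupport fun x : ℝ × ℝ =>
      (‖-Complex.I * fderiv ℝ u x (1, 0) + ((Φ * (x.2 / sqnorm x) : ℝ) : ℂ) * u x‖ ^ 2 +
       ‖-Complex.I * fderiv ℝ u x (0, 1) + ((Φ * (-x.1 / sqnorm x) : ℝ) : ℂ) * u x‖ ^ 2) :=
    HasCompactSupport.intro hcs.isCompact fun x hx => by simp [hu0 x hx, hdu0 x hx]
  calc distToInt Φ ^ 2 * ∫ x : ℝ × ℝ, ‖u x‖ ^ 2 / sqnorm x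
      ≤ ∫ x : ℝ × ℝ, ‖angularDeriv Φ u x‖ ^ 2 / sqnorm x := by
        rw [integral_eq_polar hKc hKs, integral_eq_polar hHc hHs, ← integral_const_mul]
        refine setIntegral_mono_on ((integrableOn_integral_polar hKc hKs).const_mul _)
          (integrableOn_integral_polar hHc hHs) measurableSet_Ioi fun r hr => ?_
        have hr0 : (0 : ℝ) < r := hr
        have hsq (θ : ℝ) : sqnorm (r * Real.cos θ, r * Real.sin θ) = r ^ 2 := by
          simp only [sqnorm]
          linear_combination r ^ 2 * Real.sin_sq_add_cos_sq θ
        have hderiv (θ : ℝ) : HasDerivAt (fun t => u (r * Real.cos t, r * Real.sin t))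
            (fderiv ℝ u (r * Real.cos θ, r * Real.sin θ)
              (-(r * Real.sin θ), r * Real.cos θ)) θ := by
          have hp : HasDerivAt (fun t => (r * Real.cos t, r * Real.sin t))
              (-(r * Real.sin θ), r * Real.cos θ) θ := by
            simpa using ((Real.hasDerivAt_cos θ).const_mul r).prodMk
              ((Real.hasDerivAt_sin θ).const_mul r)
          exact (hdiff _).hasFDerivAt.comp_hasDerivAt θ hp
        have hcirc := circle_magnetic_inequality Φ hderiv (by fun_prop) (by simp)
        simp only [hsq, mul_div_left_comm r, intervalIntegral.integral_mul_const]
        rw [← mul_assoc]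
        exact mul_le_mul_of_nonneg_right hcirc (by positivity)
    _ ≤ magEnergy Φ u :=
        integral_mono (hHc.integrable_of_hasCompactSupport hHs)
          (hGc.integrable_of_hasCompactSupport hGs) (angularDeriv_le Φ u)
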